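/- arXiv:hep-th/9506089 — 3 statements merged into one kernel-verified Lean document; each statement's English description precedes it below -/
import Mathlib

section
/- Let p and p̄ be integers with p ≥ 1 and p̄ ≥ 1, let ħ > 0 and λ > 0 be real numbers, and let j be an integer with 2j < −(p̄ + 1). Then λ^p · J_j(λ) = ħ·((j+1)/p̄ + (p̄−1)/(2p̄)) · J_{j+p̄}(λ) + J_{j−p}(λ). (In particular all three integrals involved converge.) -/
open MeasureTheory Set

/-- The integrand of the generating function `J_j(λ)` (at `t̄ = 0`) of the
`(p, p̄)` family of solutions of the Toda lattice hierarchy. -/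
noncomputable def Jint (p pb : ℤ) (hbar lam : ℝ) (j : ℤ) (μ : ℝ) : ℝ :=
  μ ^ (((pb : ℝ) - 1) / 2 - (j : ℝ) - 1) *
    Real.exp (hbar⁻¹ * (lam ^ (p : ℝ) * μ ^ (pb : ℝ) -
      ((pb : ℝ) / ((p : ℝ) + (pb : ℝ))) * μ ^ ((p : ℝ) + (pb : ℝ))))

/-- The generating function `J_j(λ)`. -/
noncomputable def J (p pb : ℤ) (hbar lam : ℝ) (j : ℤ) : ℝ :=
  ∫ μ in Ioi (0 : ℝ), Jint p pb hbar lam j μ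

/-- A lower power is absorbed by half of a higher one, up to a constant. -/
theorem exists_mul_rpow_sub_mul_rpow_le {A B q r : ℝ} (hA : 0 ≤ A) (hB : 0 < B) (hq : 0 < q)
    (hqr : q < r) :
    ∃ C : ℝ, ∀ x : ℝ, 0 < x → A * x ^ q - B * x ^ r ≤ C + -(B / 2) * x ^ r := by
  have hd : 0 < r - q := sub_pos.2 hqr
  have hAB : 0 ≤ 2 * A / B := by positivity
  set T : ℝ := (2 * A / B) ^ (r - q)⁻¹ with hT
  have hT0 : 0 ≤ T := Real.rpow_nonneg hAB _
  refine ⟨A * T ^ q, fun x hx => ?_⟩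
  rcases le_total x T with h | h
  · have h1 : A * x ^ q ≤ A * T ^ q := by gcongr
    have h2 : 0 ≤ B * x ^ r := by positivity
    linarith
  · have h1 : 2 * A / B ≤ x ^ (r - q) := by
      calc 2 * A / B = T ^ (r - q) := by rw [hT, Real.rpow_inv_rpow hAB hd.ne']
        _ ≤ x ^ (r - q) := by gcongr
    rw [div_le_iff₀ hB] at h1
    have h2 : x ^ r = x ^ (r - q) * x ^ q := by
      rw [← Real.rpow_add hx, sub_add_cancel]
    have h3 : 2 * A * x ^ q ≤ x ^ (r - q) * B * x ^ q := by gcongr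
    have h4 : 0 ≤ A * T ^ q := by positivity
    rw [h2]
    linarith

theorem integrableOn_rpow_mul_exp_mul_rpow_sub_mul_rpow {A B q r s : ℝ} (hA : 0 ≤ A) (hB : 0 < B)
    (hq : 0 < q) (hqr : q < r) (hs : -1 < s) :
    IntegrableOn (fun x : ℝ => x ^ s * Real.exp (A * x ^ q - B * x ^ r)) (Ioi 0) := by
  obtain ⟨C, hC⟩ := exists_mul_rpow_sub_mul_rpow_le hA hB hq hqr
  have hdom := (integrableOn_rpow_mul_exp_neg_mul_rpow hs (hq.trans hqr)
    (half_pos hB)).const_mul (Real.exp C)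
  refine Integrable.mono' hdom (by fun_prop) ?_
  filter_upwards [ae_restrict_mem measurableSet_Ioi] with x hx
  have hx : 0 < x := hx
  rw [Real.norm_of_nonneg (by positivity), mul_left_comm, ← Real.exp_add]
  gcongr
  exact hC x hx

theorem hasDerivAt_rpow_mul_exp_mul_rpow_sub_mul_rpow (A B q r c : ℝ) {x : ℝ} (hx : 0 < x) :
    HasDerivAt (fun x : ℝ => x ^ c * Real.exp (A * x ^ q - B * x ^ r))
      (c * (x ^ (c - 1) * Real.exp (A * x ^ q - B * x ^ r)) +
        (A * q * (x ^ (c + q - 1) * Real.exp (A * x ^ q - B * x ^ r)) -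
          B * r * (x ^ (c + r - 1) * Real.exp (A * x ^ q - B * x ^ r)))) x := by
  have hpow (a : ℝ) : HasDerivAt (fun x : ℝ => x ^ a) (a * x ^ (a - 1)) x :=
    Real.hasDerivAt_rpow_const (Or.inl hx.ne')
  refine ((hpow c).mul (((hpow q).const_mul A).sub ((hpow r).const_mul B)).exp).congr_deriv ?_
  simp only [Pi.sub_apply]
  rw [add_sub_assoc c q, add_sub_assoc c r, Real.rpow_add hx, Real.rpow_add hx]
  ring

/-- Integration by parts for `x ^ c * exp (A * x ^ q - B * x ^ r)` on the half-line. -/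
theorem integral_rpow_mul_exp_mul_rpow_sub_mul_rpow {A B q r c : ℝ} (hA : 0 ≤ A) (hB : 0 < B)
    (hq : 0 < q) (hqr : q < r) (hc : 0 < c) :
    c * (∫ x in Ioi (0 : ℝ), x ^ (c - 1) * Real.exp (A * x ^ q - B * x ^ r)) +
      (A * q * (∫ x in Ioi (0 : ℝ), x ^ (c + q - 1) * Real.exp (A * x ^ q - B * x ^ r)) -
        B * r * (∫ x in Ioi (0 : ℝ), x ^ (c + r - 1) * Real.exp (A * x ^ q - B * x ^ r))) = 0 := by
  have integrable_aux {s : ℝ} (hs : -1 < s) :=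
    integrableOn_rpow_mul_exp_mul_rpow_sub_mul_rpow hA hB hq hqr hs
  have h₁ := (integrable_aux (s := c - 1) (by linarith)).const_mul c
  have h₂ := (integrable_aux (s := c + q - 1) (by linarith)).const_mul (A * q)
  have h₃ := (integrable_aux (s := c + r - 1) (by linarith)).const_mul (B * r)
  have hderiv (x : ℝ) (hx : x ∈ Ioi (0 : ℝ)) :=
    hasDerivAt_rpow_mul_exp_mul_rpow_sub_mul_rpow A B q r c hx
  have hderiv_int := h₁.add (h₂.sub h₃)
  have hlim := tendsto_zero_of_hasDerivAt_of_integrableOn_Ioi hderiv hderiv_int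
    (integrable_aux (s := c) (by linarith))
  have hcont : Continuous (fun x : ℝ => x ^ c * Real.exp (A * x ^ q - B * x ^ r)) := by
    have hpow {a : ℝ} (ha : 0 < a) : Continuous (fun x : ℝ => x ^ a) :=
      Real.continuous_rpow_const ha.le
    exact (hpow hc).mul (((hpow hq).const_mul A).sub ((hpow (hq.trans hqr)).const_mul B)).rexp
  have key := integral_Ioi_of_hasDerivAt_of_tendsto hcont.continuousWithinAt hderiv hderiv_int hlim
  rw [integral_add h₁ (by exact h₂.sub h₃), integral_sub h₂ h₃] at key
  simpa only [integral_const_mul, Real.zero_rpow hc.ne', zero_mul, sub_zero] using key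

theorem Jint_eq (p pb : ℤ) (hbar lam : ℝ) (j : ℤ) :
    Jint p pb hbar lam j = fun μ : ℝ => μ ^ (((pb : ℝ) - 1) / 2 - (j : ℝ) - 1) *
      Real.exp (hbar⁻¹ * lam ^ (p : ℝ) * μ ^ (pb : ℝ) -
        hbar⁻¹ * ((pb : ℝ) / ((p : ℝ) + (pb : ℝ))) * μ ^ ((p : ℝ) + (pb : ℝ))) := by
  funext μ
  simp only [Jint, mul_sub, mul_assoc]

theorem integral_eq_J (p pb : ℤ) (hbar lam : ℝ) (j : ℤ) :
    ∫ μ in Ioi (0 : ℝ), μ ^ (((pb : ℝ) - 1) / 2 - (j : ℝ) - 1) *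
      Real.exp (hbar⁻¹ * lam ^ (p : ℝ) * μ ^ (pb : ℝ) -
        hbar⁻¹ * ((pb : ℝ) / ((p : ℝ) + (pb : ℝ))) * μ ^ ((p : ℝ) + (pb : ℝ))) =
      J p pb hbar lam j := by
  rw [J, Jint_eq]

theorem stmt_0 (p pb : ℤ) (hp : 1 ≤ p) (hpb : 1 ≤ pb)
    (hbar lam : ℝ) (hhbar : 0 < hbar) (hlam : 0 < lam)
    (j : ℤ) (hj : 2 * j < -(pb + 1)) :
    IntegrableOn (Jint p pb hbar lam j) (Ioi 0) ∧
    IntegrableOn (Jint p pb hbar lam (j + pb)) (Ioi 0) ∧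
    IntegrableOn (Jint p pb hbar lam (j - p)) (Ioi 0) ∧
    lam ^ (p : ℝ) * J p pb hbar lam j =
      hbar * (((j : ℝ) + 1) / (pb : ℝ) + ((pb : ℝ) - 1) / (2 * (pb : ℝ))) *
          J p pb hbar lam (j + pb) +
        J p pb hbar lam (j - p) := by
  have hp' : (1 : ℝ) ≤ p := by exact_mod_cast hp
  have hpb' : (1 : ℝ) ≤ pb := by exact_mod_cast hpb
  have hj' : 2 * (j : ℝ) < -(pb + 1) := by exact_mod_cast hj
  have hp0 : (0 : ℝ) < p := by linarith
  have hq : (0 : ℝ) < pb := by linarith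
  have hqr : (pb : ℝ) < p + pb := by linarith
  have hA : 0 ≤ hbar⁻¹ * lam ^ (p : ℝ) := by positivity
  have hB : 0 < hbar⁻¹ * ((pb : ℝ) / ((p : ℝ) + (pb : ℝ))) := by positivity
  have integrable_aux (k : ℤ) (hk : -1 < ((pb : ℝ) - 1) / 2 - (k : ℝ) - 1) :
      IntegrableOn (Jint p pb hbar lam k) (Ioi 0) := by
    rw [Jint_eq]
    exact integrableOn_rpow_mul_exp_mul_rpow_sub_mul_rpow hA hB hq hqr hk
  refine ⟨integrable_aux _ (by linarith), integrable_aux _ (by push_cast; linarith),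
    integrable_aux _ (by push_cast; linarith), ?_⟩
  have key := integral_rpow_mul_exp_mul_rpow_sub_mul_rpow hA hB hq hqr
    (c := -((pb : ℝ) + 1) / 2 - j) (by linarith)
  rw [show -((pb : ℝ) + 1) / 2 - j - 1 = ((pb : ℝ) - 1) / 2 - ((j + pb : ℤ) : ℝ) - 1 by
      push_cast; ring,
    show -((pb : ℝ) + 1) / 2 - j + pb - 1 = ((pb : ℝ) - 1) / 2 - j - 1 by ring,
    show -((pb : ℝ) + 1) / 2 - j + (p + pb) - 1 = ((pb : ℝ) - 1) / 2 - ((j - p : ℤ) : ℝ) - 1 by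
      push_cast; ring,
    integral_eq_J, integral_eq_J, integral_eq_J] at key
  have hr : (p : ℝ) + pb ≠ 0 := by positivity
  have hh := hhbar.ne'
  have hq0 := hq.ne'
  rw [mul_assoc hbar⁻¹ _ ((p : ℝ) + pb), div_mul_cancel₀ _ hr] at key
  field_simp at key ⊢
  linarith
end

section
/- Let p be an integer with p ≥ 1, let ħ > 0 and λ > 0 be real numbers, and let j be an integer with j ≤ −2. Then λ^p · I_j(λ) = ħ·(j+1)·I_{j+1}(λ) + I_{j−p}(λ). (In particular all three integrals involved converge.) -/
open MeasureTheory Set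

/-- The integrand of the generating function `I_j(λ)` of the `p`-th generalized
Kontsevich model, extended to negative indices `j`. -/
noncomputable def Iint (p : ℤ) (hbar lam : ℝ) (j : ℤ) (μ : ℝ) : ℝ :=
  μ ^ (-(j : ℝ) - 1) *
    Real.exp (hbar⁻¹ * (lam ^ (p : ℝ) * μ - μ ^ ((p : ℝ) + 1) / ((p : ℝ) + 1)))

/-- The generating function `I_j(λ)`. -/
noncomputable def I (p : ℤ) (hbar lam : ℝ) (j : ℤ) : ℝ :=
  ∫ μ in Ioi (0 : ℝ), Iint p hbar lam j μ

open Filter Topology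

/-- Young's inequality gives exponential decay of the integrand, uniformly on `(0, ∞)`. -/
lemma exists_Iint_le (p : ℤ) (hp : 1 ≤ p) (hbar lam : ℝ) (hhbar : 0 < hbar) (hlam : 0 < lam) :
    ∃ C : ℝ, ∀ (j : ℤ) (x : ℝ), 0 ≤ x →
      Iint p hbar lam j x ≤ C * (x ^ (-(j : ℝ) - 1) * Real.exp (-1 * x)) := by
  have hp' : (1 : ℝ) ≤ p := by exact_mod_cast hp
  have hq : ((p : ℝ) + 1).HolderConjugate (((p : ℝ) + 1).conjExponent) :=
    Real.HolderConjugate.conjExponent (by linarith)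
  set K := lam ^ (p : ℝ) + hbar with hK
  have hK0 : 0 ≤ K := by positivity
  set D := K ^ ((p : ℝ) + 1).conjExponent / ((p : ℝ) + 1).conjExponent
  refine ⟨Real.exp (hbar⁻¹ * D), fun j x hx => ?_⟩
  have young := Real.young_inequality_of_nonneg hx hK0 hq
  have hexp : hbar⁻¹ * (lam ^ (p : ℝ) * x - x ^ ((p : ℝ) + 1) / ((p : ℝ) + 1)) ≤
      hbar⁻¹ * D + -1 * x := by
    calc _ ≤ hbar⁻¹ * (D - hbar * x) := by
          refine mul_le_mul_of_nonneg_left ?_ (by positivity)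
          linear_combination young + x * hK
      _ = _ := by field_simp; ring
  calc Iint p hbar lam j x
      ≤ x ^ (-(j : ℝ) - 1) * Real.exp (hbar⁻¹ * D + -1 * x) := by
        unfold Iint
        gcongr
    _ = _ := by rw [Real.exp_add]; ring

lemma Iint_nonneg (p : ℤ) (hbar lam : ℝ) (j : ℤ) {x : ℝ} (hx : 0 ≤ x) :
    0 ≤ Iint p hbar lam j x := by
  unfold Iint
  positivity

lemma integrableOn_Iint (p : ℤ) (hp : 1 ≤ p) (hbar lam : ℝ) (hhbar : 0 < hbar)
    (hlam : 0 < lam) (j : ℤ) (hj : j < 0) :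
    IntegrableOn (Iint p hbar lam j) (Ioi 0) := by
  obtain ⟨C, hC⟩ := exists_Iint_le p hp hbar lam hhbar hlam
  have hj' : (j : ℝ) < 0 := by exact_mod_cast hj
  have hdom := (integrableOn_rpow_mul_exp_neg_mul_rpow (p := 1) (s := -(j : ℝ) - 1) (b := 1)
    (by linarith) one_pos one_pos).const_mul C
  simp only [Real.rpow_one] at hdom
  refine hdom.mono' ?_ ?_
  · have : Measurable (Iint p hbar lam j) := by
      unfold Iint
      fun_prop
    exact this.aestronglyMeasurable
  · filter_upwards [ae_restrict_mem measurableSet_Ioi] with x hx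
    rw [Real.norm_of_nonneg (Iint_nonneg p hbar lam j (le_of_lt hx))]
    exact hC j x (le_of_lt hx)

lemma tendsto_Iint_atTop (p : ℤ) (hp : 1 ≤ p) (hbar lam : ℝ) (hhbar : 0 < hbar)
    (hlam : 0 < lam) (j : ℤ) : Tendsto (Iint p hbar lam j) atTop (𝓝 0) := by
  obtain ⟨C, hC⟩ := exists_Iint_le p hp hbar lam hhbar hlam
  have hdom := (tendsto_rpow_mul_exp_neg_mul_atTop_nhds_zero (-(j : ℝ) - 1) 1 one_pos).const_mul C
  rw [mul_zero] at hdom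
  refine tendsto_of_tendsto_of_tendsto_of_le_of_le' tendsto_const_nhds hdom ?_ ?_
  · filter_upwards [eventually_ge_atTop 0] with x hx using Iint_nonneg p hbar lam j hx
  · filter_upwards [eventually_ge_atTop 0] with x hx using hC j x hx

lemma hasDerivAt_Iint (p : ℤ) (hp : 1 ≤ p) (hbar lam : ℝ) (j : ℤ) {x : ℝ} (hx : 0 < x) :
    HasDerivAt (Iint p hbar lam j)
      (-((j : ℝ) + 1) * Iint p hbar lam (j + 1) x +
        hbar⁻¹ * (lam ^ (p : ℝ) * Iint p hbar lam j x - Iint p hbar lam (j - p) x)) x := by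
  have hp' : (1 : ℝ) ≤ p := by exact_mod_cast hp
  have hp0 : (p : ℝ) + 1 ≠ 0 := by linarith
  have h1 := Real.hasDerivAt_rpow_const (x := x) (p := -(j : ℝ) - 1) (Or.inl hx.ne')
  have h2 := (Real.hasDerivAt_rpow_const (x := x) (p := (p : ℝ) + 1) (Or.inl hx.ne')).div_const
    ((p : ℝ) + 1)
  have h3 := ((((hasDerivAt_id x).const_mul (lam ^ (p : ℝ))).sub h2).const_mul hbar⁻¹).exp
  refine (h1.mul h3).congr_deriv ?_
  have e1 : -((j + 1 : ℤ) : ℝ) - 1 = -(j : ℝ) - 1 - 1 := by push_cast; ring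
  have e2 : x ^ (-((j - p : ℤ) : ℝ) - 1) = x ^ (-(j : ℝ) - 1) * x ^ (p : ℝ) := by
    rw [← Real.rpow_add hx]
    push_cast
    ring_nf
  simp only [Iint, e1, e2, id, Pi.sub_apply, add_sub_cancel_right, mul_div_cancel_left₀ _ hp0]
  ring

theorem stmt_3 (p : ℤ) (hp : 1 ≤ p)
    (hbar lam : ℝ) (hhbar : 0 < hbar) (hlam : 0 < lam)
    (j : ℤ) (hj : j ≤ -2) :
    IntegrableOn (Iint p hbar lam j) (Ioi 0) ∧
    IntegrableOn (Iint p hbar lam (j + 1)) (Ioi 0) ∧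
    IntegrableOn (Iint p hbar lam (j - p)) (Ioi 0) ∧
    lam ^ (p : ℝ) * I p hbar lam j =
      hbar * ((j : ℝ) + 1) * I p hbar lam (j + 1) + I p hbar lam (j - p) := by
  have i1 := integrableOn_Iint p hp hbar lam hhbar hlam j (by omega)
  have i2 := integrableOn_Iint p hp hbar lam hhbar hlam (j + 1) (by omega)
  have i3 := integrableOn_Iint p hp hbar lam hhbar hlam (j - p) (by omega)
  refine ⟨i1, i2, i3, ?_⟩
  have hj' : (j : ℝ) ≤ -2 := by exact_mod_cast hj
  have hp' : (1 : ℝ) ≤ p := by exact_mod_cast hp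
  have hcont : Continuous (Iint p hbar lam j) := by
    unfold Iint
    have c1 := Real.continuous_rpow_const (q := -(j : ℝ) - 1) (by linarith)
    have c2 := Real.continuous_rpow_const (q := (p : ℝ) + 1) (by linarith)
    fun_prop
  have hzero : Iint p hbar lam j 0 = 0 := by
    have : -(j : ℝ) - 1 ≠ 0 := by linarith
    simp [Iint, Real.zero_rpow this]
  have i4 : IntegrableOn (fun x => lam ^ (p : ℝ) * Iint p hbar lam j x -
      Iint p hbar lam (j - p) x) (Ioi 0) := (i1.const_mul (lam ^ (p : ℝ))).sub i3
  have key := integral_Ioi_of_hasDerivAt_of_tendsto hcont.continuousWithinAt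
    (fun _ hx => hasDerivAt_Iint p hp hbar lam j hx)
    ((i2.const_mul (-((j : ℝ) + 1))).add (i4.const_mul hbar⁻¹))
    (tendsto_Iint_atTop p hp hbar lam hhbar hlam j)
  rw [hzero, sub_zero, integral_add (i2.const_mul _) (i4.const_mul _), integral_const_mul,
    integral_const_mul, integral_sub (i1.const_mul _) i3, integral_const_mul] at key
  change -((j : ℝ) + 1) * I p hbar lam (j + 1) +
    hbar⁻¹ * (lam ^ (p : ℝ) * I p hbar lam j - I p hbar lam (j - p)) = 0 at key
  field_simp at key
  linarith
end

section
/- Let p and p̄ be integers with p ≥ 1 and p̄ ≥ 1, let ħ > 0 and μ > 0 be real numbers, and let i be an integer with 2i > p − 1. Then μ^p̄ · K_i(μ) = ħ·(−i/p + (p−1)/(2p)) · K_{i−p}(μ) + K_{i+p̄}(μ). (In particular all three integrals involved converge.) -/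
open MeasureTheory Set

/-- The integrand of the dual generating function `K_i(μ) = ū_i(μ)` of the
`(p, p̄)` family of solutions of the Toda lattice hierarchy. -/
noncomputable def Kint (p pb : ℤ) (hbar mu : ℝ) (i : ℤ) (lam : ℝ) : ℝ :=
  lam ^ (((p : ℝ) - 1) / 2 + (i : ℝ)) *
    Real.exp (hbar⁻¹ * (lam ^ (p : ℝ) * mu ^ (pb : ℝ) -
      ((p : ℝ) / ((p : ℝ) + (pb : ℝ))) * lam ^ ((p : ℝ) + (pb : ℝ))))

/-- The dual generating function `K_i(μ)`. -/
noncomputable def K (p pb : ℤ) (hbar mu : ℝ) (i : ℤ) : ℝ :=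
  ∫ lam in Ioi (0 : ℝ), Kint p pb hbar mu i lam

/-- A power `x ^ p` is dominated by any positive multiple of `x ^ (p + q)`, up to a constant. -/
lemma exists_mul_rpow_le_mul_rpow_add {p q : ℝ} (hp : 0 < p) (hq : 0 < q) (a : ℝ) {c : ℝ}
    (ha : 0 < a) (hc : 0 < c) :
    ∃ C : ℝ, ∀ x : ℝ, 0 < x → a * x ^ p ≤ c * x ^ (p + q) + C := by
  refine ⟨a * ((a / c) ^ q⁻¹) ^ p, fun x hx => ?_⟩
  have hT : 0 < a / c := div_pos ha hc
  rcases le_total x ((a / c) ^ q⁻¹) with h | h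
  · have h1 : x ^ p ≤ ((a / c) ^ q⁻¹) ^ p := Real.rpow_le_rpow hx.le h hp.le
    have h2 : 0 < c * x ^ (p + q) := by positivity
    have h3 := mul_le_mul_of_nonneg_left h1 ha.le
    linarith
  · have h1 : ((a / c) ^ q⁻¹) ^ q ≤ x ^ q := Real.rpow_le_rpow (by positivity) h hq.le
    rw [Real.rpow_inv_rpow hT.le hq.ne', div_le_iff₀ hc] at h1
    have h2 : 0 < a * ((a / c) ^ q⁻¹) ^ p := by positivity
    have h3 : 0 < x ^ p := by positivity
    rw [Real.rpow_add hx]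
    nlinarith [mul_le_mul_of_nonneg_right h1 h3.le]

lemma integrableOn_rpow_mul_exp_mul_rpow_sub {p q r h m d : ℝ} (hp : 0 < p) (hq : 0 < q)
    (hr : -1 < r) (hh : 0 < h) (hm : 0 < m) (hd : 0 < d) :
    IntegrableOn (fun x : ℝ => x ^ r * Real.exp (h * (x ^ p * m - d * x ^ (p + q))))
      (Ioi 0) := by
  obtain ⟨C, hC⟩ := exists_mul_rpow_le_mul_rpow_add hp hq (h * m) (c := h * d / 2)
    (by positivity) (by positivity)
  have hint := (integrableOn_rpow_mul_exp_neg_mul_rpow (b := h * d / 2) hr (add_pos hp hq)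
    (by positivity)).const_mul (Real.exp C)
  refine Integrable.mono' hint (Measurable.aestronglyMeasurable (by fun_prop)) ?_
  refine (ae_restrict_iff' measurableSet_Ioi).2 (Filter.Eventually.of_forall fun x hx => ?_)
  have hx : 0 < x := hx
  rw [Real.norm_of_nonneg (by positivity), mul_left_comm, ← Real.exp_add]
  gcongr
  linarith [hC x hx]

lemma hasDerivAt_rpow_mul_exp_mul_rpow_sub {p q : ℝ} (hpq : p + q ≠ 0) (s h m : ℝ) {x : ℝ}
    (hx : 0 < x) :
    HasDerivAt (fun x : ℝ => x ^ s * Real.exp (h * (x ^ p * m - p / (p + q) * x ^ (p + q))))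
      (s * (x ^ (s - 1) * Real.exp (h * (x ^ p * m - p / (p + q) * x ^ (p + q)))) +
        h * p * (m * (x ^ (s - 1 + p) *
            Real.exp (h * (x ^ p * m - p / (p + q) * x ^ (p + q)))) -
          x ^ (s - 1 + p + q) *
            Real.exp (h * (x ^ p * m - p / (p + q) * x ^ (p + q))))) x := by
  have hpow (t : ℝ) : HasDerivAt (fun y : ℝ => y ^ t) (t * x ^ (t - 1)) x :=
    Real.hasDerivAt_rpow_const (Or.inl hx.ne')
  have H := (hpow s).mul
    ((((hpow p).mul_const m).sub ((hpow (p + q)).const_mul (p / (p + q)))).const_mul h).exp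
  refine H.congr_deriv ?_
  have e1 : x ^ (s - 1 + p) = x ^ s * x ^ (p - 1) := by
    rw [← Real.rpow_add hx]; congr 1; ring
  have e2 : x ^ (s - 1 + p + q) = x ^ s * x ^ (p + q - 1) := by
    rw [← Real.rpow_add hx]; congr 1; ring
  rw [e1, e2]
  simp only [Pi.sub_apply]
  field_simp

/-- Integration by parts for the weight `exp (h * (x ^ p * m - p / (p + q) * x ^ (p + q)))`. -/
lemma integral_rpow_mul_exp_mul_rpow_sub_relation {p q s h m : ℝ} (hp : 0 < p) (hq : 0 < q)
    (hs : 0 < s) (hh : 0 < h) (hm : 0 < m) :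
    s * (∫ x in Ioi (0 : ℝ), x ^ (s - 1) *
        Real.exp (h * (x ^ p * m - p / (p + q) * x ^ (p + q)))) +
      h * p * (m * (∫ x in Ioi (0 : ℝ), x ^ (s - 1 + p) *
          Real.exp (h * (x ^ p * m - p / (p + q) * x ^ (p + q)))) -
        ∫ x in Ioi (0 : ℝ), x ^ (s - 1 + p + q) *
          Real.exp (h * (x ^ p * m - p / (p + q) * x ^ (p + q)))) = 0 := by
  have hint (r : ℝ) (hr : -1 < r) := integrableOn_rpow_mul_exp_mul_rpow_sub (d := p / (p + q))
    hp hq hr hh hm (by positivity)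
  have i0 := hint (s - 1) (by linarith)
  have i1 := hint (s - 1 + p) (by linarith)
  have i2 := hint (s - 1 + p + q) (by linarith)
  have hderiv (x : ℝ) (hx : x ∈ Ioi (0 : ℝ)) :=
    hasDerivAt_rpow_mul_exp_mul_rpow_sub (add_pos hp hq).ne' s h m hx
  have hsub := ((i1.const_mul m).sub i2).const_mul (h * p)
  simp only [Pi.sub_apply] at hsub
  have hint' := (i0.const_mul s).add hsub
  have hlim := tendsto_zero_of_hasDerivAt_of_integrableOn_Ioi hderiv hint' (hint s (by linarith))
  have hcont : ContinuousWithinAt (fun x : ℝ => x ^ s *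
      Real.exp (h * (x ^ p * m - p / (p + q) * x ^ (p + q)))) (Ici 0) 0 := by
    have hc (t : ℝ) (ht : 0 < t) : Continuous fun x : ℝ => x ^ t :=
      Real.continuous_rpow_const ht.le
    have := hc s hs
    have := hc p hp
    have := hc (p + q) (add_pos hp hq)
    exact Continuous.continuousWithinAt (by fun_prop)
  have key := integral_Ioi_of_hasDerivAt_of_tendsto hcont hderiv hint' hlim
  rw [integral_add (i0.const_mul s) hsub, integral_const_mul, integral_const_mul,
    integral_sub (i1.const_mul m) i2, integral_const_mul, Real.zero_rpow hs.ne'] at key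
  simpa using key

theorem stmt_7 (p pb : ℤ) (hp : 1 ≤ p) (hpb : 1 ≤ pb)
    (hbar mu : ℝ) (hhbar : 0 < hbar) (hmu : 0 < mu)
    (i : ℤ) (hi : p - 1 < 2 * i) :
    IntegrableOn (Kint p pb hbar mu i) (Ioi 0) ∧
    IntegrableOn (Kint p pb hbar mu (i - p)) (Ioi 0) ∧
    IntegrableOn (Kint p pb hbar mu (i + pb)) (Ioi 0) ∧
    mu ^ (pb : ℝ) * K p pb hbar mu i =
      hbar * (-(i : ℝ) / (p : ℝ) + ((p : ℝ) - 1) / (2 * (p : ℝ))) * K p pb hbar mu (i - p) +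
        K p pb hbar mu (i + pb) := by
  have hp' : (1 : ℝ) ≤ p := by exact_mod_cast hp
  have hpb' : (1 : ℝ) ≤ pb := by exact_mod_cast hpb
  have hi' : (p : ℝ) - 1 < 2 * i := by exact_mod_cast hi
  have hp0 : (0 : ℝ) < p := by linarith
  have hpb0 : (0 : ℝ) < pb := by linarith
  have hm : 0 < mu ^ (pb : ℝ) := Real.rpow_pos_of_pos hmu _
  have hint (j : ℤ) (hj : -1 < ((p : ℝ) - 1) / 2 + (j : ℝ)) :
      IntegrableOn (Kint p pb hbar mu j) (Ioi 0) :=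
    integrableOn_rpow_mul_exp_mul_rpow_sub hp0 hpb0 hj (inv_pos.2 hhbar) hm (by positivity)
  refine ⟨hint _ (by linarith), hint _ (by push_cast; linarith), hint _ (by push_cast; linarith),
    ?_⟩
  have key := integral_rpow_mul_exp_mul_rpow_sub_relation (s := (i : ℝ) - ((p : ℝ) - 1) / 2)
    hp0 hpb0 (by linarith) (inv_pos.2 hhbar) hm
  have e0 : (i : ℝ) - ((p : ℝ) - 1) / 2 - 1 = ((p : ℝ) - 1) / 2 + ((i - p : ℤ) : ℝ) := by
    push_cast; ring
  have e1 : ((p : ℝ) - 1) / 2 + ((i - p : ℤ) : ℝ) + p = ((p : ℝ) - 1) / 2 + (i : ℝ) := by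
    push_cast; ring
  have e2 : ((p : ℝ) - 1) / 2 + (i : ℝ) + pb = ((p : ℝ) - 1) / 2 + ((i + pb : ℤ) : ℝ) := by
    push_cast; ring
  rw [e0, e1, e2] at key
  change _ * K p pb hbar mu (i - p) + _ * (_ * K p pb hbar mu i - K p pb hbar mu (i + pb)) = 0
    at key
  field_simp at key ⊢
  linarith
end
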